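/- arXiv:2411.15671 — 5 statements merged into one kernel-verified Lean document; each statement's English description precedes it below -/
import Mathlib

section
/- Fix a natural number k ≥ 1. The map i ↦ 𝒜(k,i) is monotone nondecreasing on {1,…,k}: for all natural numbers i, i′ with 1 ≤ i ≤ i′ ≤ k, one has 𝒜(k,i) ≤ 𝒜(k,i′). -/
open Finset in
/-- The HiPPO sensitivity factor `𝒜(k, i) = (1/i) · ∏_{j=i}^{k} (1 - 1/j)`. -/
noncomputable def hippoA (k i : ℕ) : ℝ :=
  (1 / (i : ℝ)) * ∏ j ∈ Finset.Icc i k, (1 - 1 / (j : ℝ))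

/-- The product defining `hippoA` telescopes. -/
theorem hippoA_eq {k i : ℕ} (hi : 1 ≤ i) (hik : i ≤ k) :
    hippoA k i = (1 - 1 / (i : ℝ)) / k := by
  unfold hippoA
  induction k, hik using Nat.le_induction with
  | base => simp [div_eq_mul_inv, mul_comm]
  | succ k hik ih =>
    have hk : (k : ℝ) ≠ 0 := by exact_mod_cast (by lia : k ≠ 0)
    rw [Finset.prod_Icc_succ_top (by lia), ← mul_assoc, ih]
    push_cast
    field_simp
    ring

/-- for fixed `k ≥ 1`, the map `i ↦ 𝒜(k,i)` is monotone nondecreasing on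
`{1,…,k}`: the sensitivity `𝒜(k,i)` is a decreasing function of the distance `k − i`. -/
theorem stmt3 (k i i' : ℕ) (hk : 1 ≤ k) (hi : 1 ≤ i) (hii' : i ≤ i') (hi'k : i' ≤ k) :
    hippoA k i ≤ hippoA k i' := by
  rw [hippoA_eq hi (hii'.trans hi'k), hippoA_eq (hi.trans hii') hi'k]
  have hi₀ : (0 : ℝ) < i := by exact_mod_cast hi
  gcongr
end

section
/- Let G_* = (V_*, E_*) be a finite simple graph with V_* nonempty (the kernel graph). For each unordered pair {v₁, v₂} of distinct vertices of V_*, let G_{v₁,v₂} be a finite simple graph on vertex set {v₁, v₂} ∪ V_{v₁,v₂}, where the extra vertex sets V_{v₁,v₂} are pairwise disjoint and disjoint from V_*, and assume: (a) if {v₁,v₂} ∈ E_* then G_{v₁,v₂} is connected; (b) if {v₁,v₂} ∉ E_* then G_{v₁,v₂} has exactly two connected components, one containing v₁ and one containing v₂. Let G be the simple graph on V_* ∪ ⋃_{v₁,v₂} V_{v₁,v₂} whose edge set is the union of the edge sets of all the graphs G_{v₁,v₂}. Then G is connected if and only if G_* is connected. -/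
theorem SimpleGraph.Reachable.exists_adj_of_ne {V : Type*} {G : SimpleGraph V} {x y : V}
    (h : G.Reachable x y) (hne : x ≠ y) : ∃ z, G.Adj x z := by
  obtain ⟨p⟩ := h
  cases p with
  | nil => exact absurd rfl hne
  | cons hadj _ => exact ⟨_, hadj⟩

theorem SimpleGraph.Reachable.mem_of_adj_closed {V : Type*} {G : SimpleGraph V} {S : Set V}
    (hS : ∀ x y, G.Adj x y → x ∈ S → y ∈ S) {x y : V} (h : G.Reachable x y) (hx : x ∈ S) :
    y ∈ S := by
  obtain ⟨p⟩ := h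
  induction p with
  | nil => exact hx
  | cons hadj _ ih => exact ih (hS _ _ hadj hx)

/-- a factored graph assembled from a kernel graph `Gstar` on a nonempty
vertex set `Vs` by placing, for each unordered pair `{a,b}` of distinct kernel
vertices, a super-edge graph `H s(a,b)` on `{a,b} ∪ W s(a,b)` (the extra vertex sets
`W` being pairwise disjoint and disjoint from `Vs`) which is connected when
`{a,b} ∈ E(Gstar)` and otherwise has exactly two connected components, one containing
`a` and one containing `b`, is connected if and only if the kernel graph is. -/
theorem stmt9 {V : Type*} (Vs : Set V) (hVs : Vs.Nonempty)
    (Gstar : SimpleGraph ↥Vs)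
    (W : Sym2 ↥Vs → Set V) (H : Sym2 ↥Vs → SimpleGraph V)
    (hWVs : ∀ q, Disjoint (W q) Vs)
    (hWdisj : ∀ q q', q ≠ q' → Disjoint (W q) (W q'))
    (hWdiag : ∀ a : ↥Vs, W s(a, a) = ∅)
    (hHdiag : ∀ a : ↥Vs, H s(a, a) = ⊥)
    (hHsupp : ∀ (a b : ↥Vs) (x y : V), (H s(a, b)).Adj x y →
      x ∈ ({(↑a : V), ↑b} ∪ W s(a, b)) ∧ y ∈ ({(↑a : V), ↑b} ∪ W s(a, b)))
    (ha : ∀ a b : ↥Vs, a ≠ b → Gstar.Adj a b →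
      ∀ x ∈ ({(↑a : V), ↑b} ∪ W s(a, b)), (H s(a, b)).Reachable x ↑a)
    (hb : ∀ a b : ↥Vs, a ≠ b → ¬Gstar.Adj a b →
      (∀ x ∈ ({(↑a : V), ↑b} ∪ W s(a, b)),
        (H s(a, b)).Reachable x ↑a ∨ (H s(a, b)).Reachable x ↑b) ∧
      ¬(H s(a, b)).Reachable ↑a ↑b)
    (hcover : ∀ x : V, x ∈ Vs ∨ ∃ q, x ∈ W q) :
    (⨆ q, H q).Connected ↔ Gstar.Connected := by
  have mem_of_adj : ∀ (a b : ↥Vs) (x y : V), (H s(a, b)).Adj x y →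
      x = a ∨ x = b ∨ x ∈ W s(a, b) := by
    intro a b x y h
    simpa [or_assoc] using (hHsupp a b x y h).1
  have not_mem_W : ∀ (a : ↥Vs) (q : Sym2 ↥Vs), (a : V) ∉ W q := fun a q h =>
    Set.disjoint_left.1 (hWVs q) h a.2
  have kernel_mem : ∀ (q : Sym2 ↥Vs) (u : ↥Vs) (y : V), (H q).Reachable u y → (u : V) ≠ y →
      u ∈ q := by
    intro q u y h hne
    obtain ⟨z, hz⟩ := h.exists_adj_of_ne hne
    induction q with | _ c d
    rcases mem_of_adj c d _ _ hz with h | h | h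
    · simp [Subtype.ext h]
    · simp [Subtype.ext h]
    · exact absurd h (not_mem_W u _)
  have kernel_reachable : ∀ (q : Sym2 ↥Vs) (u v : ↥Vs), (H q).Reachable u v →
      Gstar.Reachable u v := by
    intro q u v h
    by_cases huv : u = v
    · rw [huv]
    have hne : (u : V) ≠ v := fun h => huv (Subtype.ext h)
    have hq : q = s(u, v) := (Sym2.mem_and_mem_iff huv).1
      ⟨kernel_mem q u v h hne, kernel_mem q v u h.symm hne.symm⟩
    by_contra hn
    exact (hb u v huv fun hadj => hn hadj.reachable).2 (hq ▸ h)
  constructor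
  · intro hG
    have : Nonempty ↥Vs := hVs.to_subtype
    refine ⟨fun a₀ b => ?_⟩
    have hmem : (b : V) ∈ {x : V | ∃ (q : Sym2 ↥Vs) (a : ↥Vs),
        Gstar.Reachable a₀ a ∧ (H q).Reachable x a} := by
      refine (hG.preconnected (a₀ : V) b).mem_of_adj_closed ?_
        ⟨s(a₀, a₀), a₀, .refl _, .refl _⟩
      rintro x y hxy ⟨q, a, ha₀, hxa⟩
      obtain ⟨q', hq'⟩ := SimpleGraph.iSup_adj.1 hxy
      by_cases hx : x ∈ Vs
      · exact ⟨q', ⟨x, hx⟩, ha₀.trans (kernel_reachable q ⟨x, hx⟩ a hxa).symm,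
          hq'.symm.reachable⟩
      have mem_W : ∀ (p : Sym2 ↥Vs) (z : V), (H p).Adj x z → x ∈ W p := by
        intro p z hz
        induction p with | _ c d
        rcases mem_of_adj c d _ _ hz with h | h | h
        · exact absurd (h ▸ c.2) hx
        · exact absurd (h ▸ d.2) hx
        · exact h
      obtain ⟨z, hz⟩ := hxa.exists_adj_of_ne fun h => hx (h ▸ a.2)
      have hqq : q' = q := by
        by_contra hne
        exact Set.disjoint_left.1 (hWdisj q' q hne) (mem_W q' y hq') (mem_W q z hz)
      subst hqq
      exact ⟨q', a, ha₀, hq'.symm.reachable.trans hxa⟩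
    obtain ⟨q, a, ha₀, hba⟩ := hmem
    exact ha₀.trans (kernel_reachable q b a hba).symm
  · intro hG
    have hle : ∀ q, H q ≤ ⨆ q, H q := le_iSup H
    have kernel_lift : ∀ a b : ↥Vs, (⨆ q, H q).Reachable (a : V) b := by
      intro a b
      refine (hG.preconnected a b).mem_of_adj_closed
        (S := {c : ↥Vs | (⨆ q, H q).Reachable (a : V) c}) ?_ (.refl _)
      intro c d hcd hc
      exact hc.trans (((ha c d hcd.ne hcd d (by simp)).mono (hle _)).symm)
    have to_kernel : ∀ x : V, ∃ a : ↥Vs, (⨆ q, H q).Reachable x a := by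
      intro x
      rcases hcover x with hx | ⟨q, hx⟩
      · exact ⟨⟨x, hx⟩, .refl _⟩
      induction q with | _ a b
      by_cases hab : a = b
      · subst hab
        simp [hWdiag] at hx
      by_cases hadj : Gstar.Adj a b
      · exact ⟨a, (ha a b hab hadj x (Or.inr hx)).mono (hle _)⟩
      rcases (hb a b hab hadj).1 x (Or.inr hx) with h | h
      · exact ⟨a, h.mono (hle _)⟩
      · exact ⟨b, h.mono (hle _)⟩
    have : Nonempty V := ⟨hVs.some⟩
    refine ⟨fun x y => ?_⟩
    obtain ⟨a, hxa⟩ := to_kernel x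
    obtain ⟨b, hyb⟩ := to_kernel y
    exact (hxa.trans (kernel_lift a b)).trans hyb.symm
end

section
/- Let b, k ≥ 1, let π_1, …, π_k be permutations of Fin b, fix s ∈ Fin b, and let U ⊆ Fin b be nonempty. Let G′ be the graph obtained from the layered matching graph L(π_1,…,π_k) by adding: an edge between (s, 0) and (w, k) for every w ∉ U, and edges forming a path through the vertices {(w, k) : w ∈ U} (so that this set becomes connected). Then G′ is connected if and only if (π_k ∘ ⋯ ∘ π_1)(s) ∈ U. (This is the reduction embedding the pointer-chasing problem into graph connectivity: G′ is connected exactly when the unique vertex of the last layer reachable from the source (s,0) lies in the target set U.) -/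
/-- `chainPerm b k p j m x` applies the permutations `p j, p (j+1), …, p (j+m-1)` in
order to `x`; in particular `chainPerm b k p 0 k x = (π_k ∘ ⋯ ∘ π_1) x`. -/
def chainPerm (b k : ℕ) (p : Fin k → Equiv.Perm (Fin b)) (j : ℕ) : ℕ → Fin b → Fin b
  | 0 => id
  | m + 1 => fun x =>
      (if h : j + m < k then p ⟨j + m, h⟩ else Equiv.refl (Fin b))
        (chainPerm b k p j m x)

/-- The layered matching graph `L(π_1,…,π_k)` on `Fin b × Fin (k+1)`: its edges are
exactly the pairs `{(x, j), (π_{j+1} x, j+1)}` for `j ∈ {0,…,k-1}` and `x : Fin b`. -/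
def layeredGraph (b k : ℕ) (p : Fin k → Equiv.Perm (Fin b)) :
    SimpleGraph (Fin b × Fin (k + 1)) :=
  SimpleGraph.fromRel (fun u v =>
    ∃ (j : Fin k) (x : Fin b), u = (x, j.castSucc) ∧ v = (p j x, j.succ))

theorem chainPerm_succ_left {b k : ℕ} (p : Fin k → Equiv.Perm (Fin b)) {j : ℕ} (hj : j < k)
    (m : ℕ) (x : Fin b) :
    chainPerm b k p j (m + 1) x = chainPerm b k p (j + 1) m (p ⟨j, hj⟩ x) := by
  induction m with
  | zero => simp [chainPerm, hj]
  | succ m ih =>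
    have h : j + (m + 1) = j + 1 + m := by omega
    change (if h : j + (m + 1) < k then p ⟨j + (m + 1), h⟩ else Equiv.refl (Fin b))
      (chainPerm b k p j (m + 1) x) = _
    rw [ih]
    simp only [h, chainPerm]

/-- The vertex of the last layer lying on the matching path through `u`. -/
def chainEnd {b k : ℕ} (p : Fin k → Equiv.Perm (Fin b)) (u : Fin b × Fin (k + 1)) : Fin b :=
  chainPerm b k p u.2 (k - u.2) u.1

theorem chainEnd_last {b k : ℕ} (p : Fin k → Equiv.Perm (Fin b)) (w : Fin b) :
    chainEnd p (w, Fin.last k) = w := by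
  simp [chainEnd, chainPerm]

theorem chainEnd_castSucc {b k : ℕ} (p : Fin k → Equiv.Perm (Fin b)) (j : Fin k) (x : Fin b) :
    chainEnd p (x, j.castSucc) = chainEnd p (p j x, j.succ) := by
  have h : k - (j : ℕ) = k - (j + 1) + 1 := by omega
  simp only [chainEnd, Fin.val_castSucc, Fin.val_succ]
  rw [h, chainPerm_succ_left p j.isLt]

theorem layeredGraph_adj {b k : ℕ} (p : Fin k → Equiv.Perm (Fin b)) (j : Fin k) (x : Fin b) :
    (layeredGraph b k p).Adj (x, j.castSucc) (p j x, j.succ) := by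
  rw [layeredGraph, SimpleGraph.fromRel_adj]
  refine ⟨fun h => ?_, Or.inl ⟨j, x, rfl, rfl⟩⟩
  exact (Fin.castSucc_lt_succ (i := j)).ne (congrArg Prod.snd h)

theorem chainEnd_eq_of_layeredGraph_adj {b k : ℕ} (p : Fin k → Equiv.Perm (Fin b))
    {u v : Fin b × Fin (k + 1)} (h : (layeredGraph b k p).Adj u v) :
    chainEnd p u = chainEnd p v := by
  rw [layeredGraph, SimpleGraph.fromRel_adj] at h
  obtain ⟨-, ⟨j, x, rfl, rfl⟩ | ⟨j, x, rfl, rfl⟩⟩ := h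
  · exact chainEnd_castSucc p j x
  · exact (chainEnd_castSucc p j x).symm

theorem layeredGraph_reachable_chainEnd {b k : ℕ} (p : Fin k → Equiv.Perm (Fin b))
    (u : Fin b × Fin (k + 1)) :
    (layeredGraph b k p).Reachable u (chainEnd p u, Fin.last k) := by
  obtain ⟨x, i⟩ := u
  induction i using Fin.reverseInduction generalizing x with
  | last => rw [chainEnd_last]
  | cast j ih =>
    rw [chainEnd_castSucc]
    exact (layeredGraph_adj p j x).reachable.trans (ih (p j x))

theorem SimpleGraph.Reachable.iff_of_adj {V : Type*} {G : SimpleGraph V} {P : V → Prop}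
    (hP : ∀ u v, G.Adj u v → (P u ↔ P v)) {u v : V} (h : G.Reachable u v) : P u ↔ P v := by
  obtain ⟨w⟩ := h
  induction w with
  | nil => exact Iff.rfl
  | cons h _ ih => exact (hP _ _ h).trans ih

/-- the graph `G'` obtained from the layered matching graph by adding an
edge between `(s, 0)` and `(w, k)` for every `w ∉ U`, together with edges (a graph `B`)
forming a path through the vertices `{(w, k) : w ∈ U}` (so that this set becomes
connected), is connected if and only if `(π_k ∘ ⋯ ∘ π_1)(s) ∈ U`. -/
theorem stmt11 (b k : ℕ) (hb : 1 ≤ b) (hk : 1 ≤ k) (p : Fin k → Equiv.Perm (Fin b))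
    (vs : Fin b) (U : Set (Fin b)) (hU : U.Nonempty)
    (B : SimpleGraph (Fin b × Fin (k + 1)))
    (hBsupp : ∀ u v, B.Adj u v →
      (∃ w ∈ U, u = (w, Fin.last k)) ∧ ∃ w ∈ U, v = (w, Fin.last k))
    (hBconn : ∀ w ∈ U, ∀ w' ∈ U, B.Reachable (w, Fin.last k) (w', Fin.last k)) :
    (layeredGraph b k p
      ⊔ SimpleGraph.fromEdgeSet {e | ∃ w : Fin b, w ∉ U ∧
          e = s(((vs, 0) : Fin b × Fin (k + 1)), (w, Fin.last k))}
      ⊔ B).Connected ↔ chainPerm b k p 0 k vs ∈ U := by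
  have hstart : chainEnd p (vs, 0) = chainPerm b k p 0 k vs := by simp [chainEnd]
  rw [← hstart]
  constructor
  · intro hconn
    obtain ⟨w, hw⟩ := hU
    refine (SimpleGraph.Reachable.iff_of_adj (P := fun u => chainEnd p (vs, 0) ∈ U ∨
      chainEnd p u ∈ U) ?_ (hconn (w, Fin.last k) (vs, 0))).1 ?_ |>.elim id id
    · rintro u v ((h | h) | h)
      · rw [chainEnd_eq_of_layeredGraph_adj p h]
      · rw [SimpleGraph.fromEdgeSet_adj] at h
        obtain ⟨⟨w, hw, he⟩, -⟩ := h
        rcases Sym2.eq_iff.1 he with ⟨rfl, rfl⟩ | ⟨rfl, rfl⟩ <;>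
          simp [chainEnd_last, hw]
      · obtain ⟨⟨w, hw, rfl⟩, w', hw', rfl⟩ := hBsupp u v h
        simp [chainEnd_last, hw, hw']
    · exact Or.inr (by rwa [chainEnd_last])
  · intro ht
    have : Nonempty (Fin b × Fin (k + 1)) := ⟨(vs, 0)⟩
    rw [SimpleGraph.connected_iff_exists_forall_reachable]
    refine ⟨(vs, 0), fun u => ?_⟩
    have hL := fun v => (layeredGraph_reachable_chainEnd p v).mono
      (le_sup_left.trans le_sup_left : _ ≤ layeredGraph b k p
        ⊔ SimpleGraph.fromEdgeSet {e | ∃ w : Fin b, w ∉ U ∧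
            e = s(((vs, 0) : Fin b × Fin (k + 1)), (w, Fin.last k))}
        ⊔ B)
    refine SimpleGraph.Reachable.trans ?_ (hL u).symm
    by_cases hu : chainEnd p u ∈ U
    · exact (hL (vs, 0)).trans ((hBconn _ ht _ hu).mono le_sup_right)
    · refine SimpleGraph.Adj.reachable (Or.inl (Or.inr ?_))
      rw [SimpleGraph.fromEdgeSet_adj]
      refine ⟨⟨_, hu, rfl⟩, fun h => ?_⟩
      have h' := congrArg (fun v : Fin b × Fin (k + 1) => (v.2 : ℕ)) h
      simp at h'
      omega
end

section
/- Let n ≥ 1, let σ_1, …, σ_n be permutations of Fin 5, let s, t ∈ Fin 5, and set σ = σ_n ∘ ⋯ ∘ σ_1. Then the permutation-composition graph P(σ_1,…,σ_n; s, t) is connected if and only if σ(s) ≠ t. (This is the reduction showing that composing a word of permutations in the symmetric group S_5—an NC¹-complete task—can be solved by evaluating the connectivity of a bounded number of graphs of this form, one for each pair (s, t).) -/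
/-- Vertices of the permutation-composition graph `P(σ_1,…,σ_n; s, t)`: the layered
vertices `Fin 5 × Fin (n+1)` together with the fresh path vertices `p_1, …, p_{n-1}`. -/
abbrev PCVert (n : ℕ) : Type := (Fin 5 × Fin (n + 1)) ⊕ Fin (n - 1)

/-- The `i`-th vertex on the special path, `i ∈ {0,…,n}`: `(s, 0)` for `i = 0`, the
fresh path vertex `p_i` for `1 ≤ i ≤ n-1`, and `(t, n)` for `i = n`. -/
def pcPathVert (n : ℕ) (vs vt : Fin 5) (i : ℕ) : PCVert n :=
  if _h0 : i = 0 then Sum.inl (vs, 0)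
  else if h : i < n then Sum.inr ⟨i - 1, by omega⟩
  else Sum.inl (vt, Fin.last n)

/-- The edge sequence of the permutation-composition graph `P(σ_1,…,σ_n; s, t)`:
for `i = 1, …, n`, the five layer-`i` edges `{(x, i−1), (σ_i x, i)}` (for `x : Fin 5`)
followed by the `i`-th path edge; finally the three path edges connecting the four
last-layer vertices `{(x, n) : x ≠ t}` in increasing order. -/
def pcEdges (n : ℕ) (σ : Fin n → Equiv.Perm (Fin 5)) (vs vt : Fin 5) :
    List (Sym2 (PCVert n)) :=
  ((List.finRange n).flatMap (fun i =>
    ((List.finRange 5).map (fun x =>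
      s((Sum.inl (x, i.castSucc) : PCVert n), (Sum.inl (σ i x, i.succ) : PCVert n))))
    ++ [s(pcPathVert n vs vt i.val, pcPathVert n vs vt (i.val + 1))]))
  ++ ((((List.finRange 5).filter (fun x => x ≠ vt)).zip
        (((List.finRange 5).filter (fun x => x ≠ vt)).tail)).map
      (fun q => s((Sum.inl (q.1, Fin.last n) : PCVert n),
                  (Sum.inl (q.2, Fin.last n) : PCVert n))))

/-- The permutation-composition graph `P(σ_1,…,σ_n; s, t)`. -/
def pcGraph (n : ℕ) (σ : Fin n → Equiv.Perm (Fin 5)) (vs vt : Fin 5) :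
    SimpleGraph (PCVert n) :=
  SimpleGraph.fromEdgeSet {e | e ∈ pcEdges n σ vs vt}

/-- The composition of the first `k` permutations of the word `σ`. -/
def partialComp {n : ℕ} (σ : Fin n → Equiv.Perm (Fin 5)) (k : ℕ) : Equiv.Perm (Fin 5) :=
  ((((List.finRange n).take k).reverse).map σ).prod

lemma partialComp_zero {n : ℕ} (σ : Fin n → Equiv.Perm (Fin 5)) : partialComp σ 0 = 1 := by
  simp [partialComp]

lemma partialComp_succ {n : ℕ} (σ : Fin n → Equiv.Perm (Fin 5)) (i : Fin n) :
    partialComp σ (i.val + 1) = σ i * partialComp σ i.val := by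
  have h : (List.finRange n).take (i.val + 1) = (List.finRange n).take i.val ++ [i] := by
    rw [List.take_add_one]
    simp
  simp [partialComp, h]

lemma partialComp_last {n : ℕ} (σ : Fin n → Equiv.Perm (Fin 5)) :
    partialComp σ n = ((List.finRange n).reverse.map σ).prod := by
  unfold partialComp
  rw [List.take_of_length_le (by simp)]

/-- If consecutive entries of a list are related by an equivalence, so are any two entries. -/
lemma Equivalence.rel_of_forall_mem_zip_tail {α : Type*} {r : α → α → Prop} (hr : Equivalence r) :
    ∀ l : List α, (∀ q ∈ l.zip l.tail, r q.1 q.2) → ∀ a ∈ l, ∀ b ∈ l, r a b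
  | [], _ => by simp
  | [a], _ => by simpa using hr.refl a
  | a :: b :: l, h => by
    have ih := rel_of_forall_mem_zip_tail hr (b :: l) fun q hq => h q (by simp_all)
    have hab : r a b := h (a, b) (by simp)
    intro x hx y hy
    have key : ∀ z ∈ a :: b :: l, r z b := fun z hz => by
      rcases List.mem_cons.1 hz with rfl | hz
      · exact hab
      · exact ih z hz b (by simp)
    exact hr.trans (key x hx) (hr.symm (key y hy))

lemma mem_pcEdges {n : ℕ} {σ : Fin n → Equiv.Perm (Fin 5)} {vs vt : Fin 5}
    {e : Sym2 (PCVert n)} :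
    e ∈ pcEdges n σ vs vt ↔
      (∃ (i : Fin n) (x : Fin 5), s(Sum.inl (x, i.castSucc), Sum.inl (σ i x, i.succ)) = e) ∨
      (∃ i : Fin n, s(pcPathVert n vs vt i.val, pcPathVert n vs vt (i.val + 1)) = e) ∨
      ∃ q ∈ ((List.finRange 5).filter (fun x => x ≠ vt)).zip
        (((List.finRange 5).filter (fun x => x ≠ vt)).tail),
        s(Sum.inl (q.1, Fin.last n), Sum.inl (q.2, Fin.last n)) = e := by
  simp only [pcEdges, List.mem_append, List.mem_flatMap, List.mem_map, List.mem_finRange,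
    true_and, List.mem_singleton, exists_or, or_assoc, @eq_comm _ e]

lemma reachable_of_mem_pcEdges {n : ℕ} {σ : Fin n → Equiv.Perm (Fin 5)} {vs vt : Fin 5}
    {a b : PCVert n} (h : s(a, b) ∈ pcEdges n σ vs vt) : (pcGraph n σ vs vt).Reachable a b := by
  by_cases hab : a = b
  · exact hab ▸ SimpleGraph.Reachable.refl a
  · exact SimpleGraph.Adj.reachable ((SimpleGraph.fromEdgeSet_adj _).2 ⟨h, hab⟩)

/-- The vertices on the trajectory of `vs` under `σ`, together with the fresh path vertices. -/
def OnTrack {n : ℕ} (σ : Fin n → Equiv.Perm (Fin 5)) (vs : Fin 5) : PCVert n → Prop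
  | Sum.inl (x, i) => partialComp σ i.val vs = x
  | Sum.inr _ => True

lemma onTrack_pcPathVert {n : ℕ} {σ : Fin n → Equiv.Perm (Fin 5)} {vs vt : Fin 5}
    (h : partialComp σ n vs = vt) (i : ℕ) : OnTrack σ vs (pcPathVert n vs vt i) := by
  unfold pcPathVert
  split_ifs
  · simp [OnTrack, partialComp_zero]
  · trivial
  · simpa [OnTrack] using h

lemma onTrack_iff_of_mem_pcEdges {n : ℕ} {σ : Fin n → Equiv.Perm (Fin 5)} {vs vt : Fin 5}
    (h : partialComp σ n vs = vt) {a b : PCVert n} (hab : s(a, b) ∈ pcEdges n σ vs vt) :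
    OnTrack σ vs a ↔ OnTrack σ vs b := by
  have key : ∀ c d, s(c, d) = s(a, b) → (OnTrack σ vs c ↔ OnTrack σ vs d) →
      (OnTrack σ vs a ↔ OnTrack σ vs b) := by
    intro c d hcd hiff
    rcases Sym2.eq_iff.1 hcd with ⟨rfl, rfl⟩ | ⟨rfl, rfl⟩
    · exact hiff
    · exact hiff.symm
  rcases mem_pcEdges.1 hab with ⟨i, x, he⟩ | ⟨i, he⟩ | ⟨q, hq, he⟩
  · refine key _ _ he ?_
    simp [OnTrack, partialComp_succ]
  · exact key _ _ he (iff_of_true (onTrack_pcPathVert h _) (onTrack_pcPathVert h _))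
  · have h1 : q.1 ≠ vt := by simpa using (List.mem_filter.1 (List.of_mem_zip hq).1).2
    have h2 : q.2 ≠ vt := by
      simpa using (List.mem_filter.1 (List.mem_of_mem_tail (List.of_mem_zip hq).2)).2
    refine key _ _ he (iff_of_false ?_ ?_)
    · simpa [OnTrack, h] using h1.symm
    · simpa [OnTrack, h] using h2.symm

lemma not_connected_pcGraph {n : ℕ} {σ : Fin n → Equiv.Perm (Fin 5)} {vs vt : Fin 5}
    (h : partialComp σ n vs = vt) : ¬ (pcGraph n σ vs vt).Connected := by
  intro hc
  have hwalk : ∀ a b : PCVert n, (pcGraph n σ vs vt).Walk a b →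
      (OnTrack σ vs a ↔ OnTrack σ vs b) := by
    intro a b w
    induction w with
    | nil => rfl
    | cons hadj _ ih =>
      exact (onTrack_iff_of_mem_pcEdges h ((SimpleGraph.fromEdgeSet_adj _).1 hadj).1).trans ih
  obtain ⟨w⟩ := hc.preconnected (Sum.inl (vs, 0)) (Sum.inl (vs + 1, 0))
  have hw := hwalk _ _ w
  simp [OnTrack, partialComp_zero] at hw

lemma reachable_partialComp {n : ℕ} (σ : Fin n → Equiv.Perm (Fin 5)) (vs vt x : Fin 5)
    (i : Fin (n + 1)) :
    (pcGraph n σ vs vt).Reachable (Sum.inl (x, 0)) (Sum.inl (partialComp σ i.val x, i)) := by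
  induction i using Fin.induction with
  | zero => simp [partialComp_zero]
  | succ i ih =>
    refine ih.trans (reachable_of_mem_pcEdges (mem_pcEdges.2
      (Or.inl ⟨i, partialComp σ i.val x, ?_⟩)))
    simp [partialComp_succ]

lemma reachable_pcPathVert {n : ℕ} (σ : Fin n → Equiv.Perm (Fin 5)) (vs vt : Fin 5)
    {k : ℕ} (hk : k ≤ n) :
    (pcGraph n σ vs vt).Reachable (Sum.inl (vs, 0)) (pcPathVert n vs vt k) := by
  induction k with
  | zero => simp [pcPathVert]
  | succ k ih =>
    exact (ih (by omega)).trans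
      (reachable_of_mem_pcEdges (mem_pcEdges.2 (Or.inr (Or.inl ⟨⟨k, by omega⟩, rfl⟩))))

lemma reachable_last {n : ℕ} (σ : Fin n → Equiv.Perm (Fin 5)) (vs : Fin 5) {vt x y : Fin 5}
    (hx : x ≠ vt) (hy : y ≠ vt) :
    (pcGraph n σ vs vt).Reachable (Sum.inl (x, Fin.last n)) (Sum.inl (y, Fin.last n)) := by
  have hr : Equivalence fun a b : Fin 5 =>
      (pcGraph n σ vs vt).Reachable (Sum.inl (a, Fin.last n)) (Sum.inl (b, Fin.last n)) :=
    ⟨fun _ => .refl _, fun h => h.symm, fun h h' => h.trans h'⟩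
  exact hr.rel_of_forall_mem_zip_tail ((List.finRange 5).filter (fun x => x ≠ vt))
    (fun q hq => reachable_of_mem_pcEdges (mem_pcEdges.2 (Or.inr (Or.inr ⟨q, hq, rfl⟩))))
    x (by simpa using hx) y (by simpa using hy)

lemma connected_pcGraph {n : ℕ} (hn : 1 ≤ n) {σ : Fin n → Equiv.Perm (Fin 5)} {vs vt : Fin 5}
    (h : partialComp σ n vs ≠ vt) : (pcGraph n σ vs vt).Connected := by
  refine SimpleGraph.connected_iff_exists_forall_reachable _ |>.2 ⟨Sum.inl (vs, 0), ?_⟩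
  have hlast : ∀ y, (pcGraph n σ vs vt).Reachable (Sum.inl (vs, 0))
      (Sum.inl (y, Fin.last n)) := by
    intro y
    by_cases hy : y = vt
    · have := reachable_pcPathVert σ vs vt le_rfl
      simpa [pcPathVert, show n ≠ 0 by omega, hy] using this
    · exact (reachable_partialComp σ vs vt vs (Fin.last n)).trans (reachable_last σ vs h hy)
  rintro (⟨x, i⟩ | j)
  · obtain ⟨y, rfl⟩ := (partialComp σ i.val).surjective x
    exact (hlast _).trans ((reachable_partialComp σ vs vt y (Fin.last n)).symm.trans
      (reachable_partialComp σ vs vt y i))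
  · have hj := j.isLt
    have := reachable_pcPathVert σ vs vt (k := j.val + 1) (by omega)
    simpa [pcPathVert, show j.val + 1 < n by omega] using this

/-- with `σ = σ_n ∘ ⋯ ∘ σ_1`, the permutation-composition graph
`P(σ_1,…,σ_n; s, t)` is connected if and only if `σ(s) ≠ t`. -/
theorem stmt12 (n : ℕ) (hn : 1 ≤ n) (σ : Fin n → Equiv.Perm (Fin 5)) (vs vt : Fin 5) :
    (pcGraph n σ vs vt).Connected ↔ ((List.finRange n).reverse.map σ).prod vs ≠ vt := by
  rw [← partialComp_last]
  exact ⟨fun hc h => not_connected_pcGraph h hc, connected_pcGraph hn⟩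
end

section
/- Let n ≥ 1, let σ_1, …, σ_n be permutations of Fin 5, and let s, t ∈ Fin 5. Order the 6n + 3 edges of the permutation-composition graph P(σ_1,…,σ_n; s, t) as follows: for i = 1, …, n, list the five layer-i edges {(x, i−1), (σ_i(x), i)} (x ∈ Fin 5) followed by the i-th path edge, and finally list the three edges connecting {(x, n) : x ≠ t}. Then this edge ordering has node locality at most 12: for every vertex v, any two indices i, j of edges containing v satisfy |i − j| ≤ 12. -/
theorem List.exists_getElem_flatMap_eq {α β : Type*} {m : ℕ} (f : α → List β)
    (hf : ∀ a, (f a).length = m) (l : List α) (i : ℕ) (hi : i < (l.flatMap f).length) :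
    ∃ (a : ℕ) (ha : a < l.length) (b : ℕ) (hb : b < (f l[a]).length),
      i = m * a + b ∧ (l.flatMap f)[i] = (f l[a])[b] := by
  induction l generalizing i with
  | nil => simp at hi
  | cons c l ih =>
    by_cases h : i < (f c).length
    · exact ⟨0, by simp, i, h, by simp, by simp [List.flatMap_cons, List.getElem_append_left h]⟩
    · have hlen : (f c).length = m := hf c
      have hi' : i - (f c).length < (l.flatMap f).length := by
        rw [List.flatMap_cons, List.length_append] at hi
        omega
      obtain ⟨a, ha, b, hb, hab, he⟩ := ih (i - (f c).length) hi'
      refine ⟨a + 1, by simpa using ha, b, hb, ?_, ?_⟩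
      · rw [mul_add]
        omega
      · simp only [List.flatMap_cons, List.getElem_cons_succ]
        rw [List.getElem_append_right (by omega), he]

/-- The position around which the edges containing a given vertex are listed. -/
def pcCenter {n : ℕ} : PCVert n → ℕ
  | Sum.inl q => 6 * q.2.val
  | Sum.inr m => 6 * m.val + 8

theorem pcCenter_pcPathVert (n : ℕ) (vs vt : Fin 5) {i : ℕ} (hi : i ≤ n) :
    6 * i ≤ pcCenter (pcPathVert n vs vt i) ∧ pcCenter (pcPathVert n vs vt i) ≤ 6 * i + 2 := by
  unfold pcPathVert
  split_ifs with h0 h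
  · simp [pcCenter, h0]
  · simp only [pcCenter]
    omega
  · simp only [pcCenter, Fin.val_last]
    omega

theorem pcCenter_near_index (n : ℕ) (σ : Fin n → Equiv.Perm (Fin 5)) (vs vt : Fin 5)
    (v : PCVert n) (i : ℕ) (hi : i < (pcEdges n σ vs vt).length)
    (hv : v ∈ (pcEdges n σ vs vt)[i]) : i ≤ pcCenter v + 6 ∧ pcCenter v ≤ i + 6 := by
  unfold pcEdges at hi hv
  rw [List.getElem_append] at hv
  split_ifs at hv with h
  · obtain ⟨a, ha, b, hb, rfl, he⟩ :=
      List.exists_getElem_flatMap_eq (m := 6) _ (fun _ => by simp) (List.finRange n) i h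
    rw [he, List.getElem_append] at hv
    rw [List.length_finRange] at ha
    simp only [List.length_append, List.length_map, List.length_finRange, List.length_singleton]
      at hb
    split_ifs at hv with hb5
    · simp only [List.length_map, List.length_finRange] at hb5
      simp only [List.getElem_map, Sym2.mem_iff, List.getElem_finRange] at hv
      rcases hv with rfl | rfl <;> simp [pcCenter] <;> omega
    · simp only [List.length_map, List.length_finRange] at hb5
      simp only [List.getElem_singleton, Sym2.mem_iff, List.getElem_finRange] at hv
      rcases hv with rfl | rfl
      · have := pcCenter_pcPathVert n vs vt (i := a) (by omega)
        simp only [Fin.val_cast]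
        omega
      · have := pcCenter_pcPathVert n vs vt (i := a + 1) (by omega)
        simp only [Fin.val_cast]
        omega
  · have hc : pcCenter v = 6 * n := by
      rw [List.getElem_map, Sym2.mem_iff] at hv
      rcases hv with rfl | rfl <;> simp [pcCenter]
    have hlen : ((List.finRange 5).filter (fun x => x ≠ vt)).length = 4 := by
      clear hi h hv
      decide +revert
    rw [List.length_append, List.length_map, List.length_zip, List.length_tail, hlen] at hi
    simp at hi h
    omega

/-- the above edge ordering of the permutation-composition graph
`P(σ_1,…,σ_n; s, t)` has node locality at most `12`: for every vertex `v`, any two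
positions `i, j` of edges containing `v` satisfy `|i − j| ≤ 12`. -/
theorem stmt13 (n : ℕ) (hn : 1 ≤ n) (σ : Fin n → Equiv.Perm (Fin 5)) (vs vt : Fin 5) :
    ∀ (v : PCVert n) (i j : ℕ) (hi : i < (pcEdges n σ vs vt).length)
      (hj : j < (pcEdges n σ vs vt).length),
      v ∈ (pcEdges n σ vs vt).get ⟨i, hi⟩ → v ∈ (pcEdges n σ vs vt).get ⟨j, hj⟩ →
      |(i : ℤ) - (j : ℤ)| ≤ 12 := by
  intro v i j hi hj hvi hvj
  have h₁ := pcCenter_near_index n σ vs vt v i hi hvi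
  have h₂ := pcCenter_near_index n σ vs vt v j hj hvj
  rw [abs_le]
  omega
end
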